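/- arXiv:1601.00037 — 4 statements merged into one kernel-verified Lean document; each statement's English description precedes it below -/
import Mathlib

section
/- Let N ≥ 1, and let k : {1,…,N}×{1,…,N} → ℝ be symmetric (k_{ij} = k_{ji}) with zero row sums (∑_{j=1}^N k_{ij} = 0 for every i). Let d ≥ 1, let n_1,…,n_N be unit vectors in ℝ^d, let s_1,…,s_N ∈ ℝ, set u_i := s_i·n_i, and let κ ∈ ℝ. Then the discrete energy identity holds: (κ/2) ∑_{i,j} k_{ij} (s_i − s_j)² + (1/2) ∑_{i,j} k_{ij} ((s_i² + s_j²)/2) ‖n_i − n_j‖² = (κ − 1)·(1/2) ∑_{i,j} k_{ij} (s_i − s_j)² + (1/2) ∑_{i,j} k_{ij} ‖u_i − u_j‖² + ∑_{i,j} k_{ij} (s_i − s_j)² ‖(n_i − n_j)/2‖². -/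
/-- For unit vectors `a`, `b`, the weighted difference `‖a - b‖²` splits into the difference of the
scaled vectors and a quadratic correction. -/
theorem mean_sq_mul_norm_sub_sq_of_unit {E : Type*} [NormedAddCommGroup E]
    [InnerProductSpace ℝ E] {a b : E} (ha : ‖a‖ = 1) (hb : ‖b‖ = 1) (x y : ℝ) :
    (x ^ 2 + y ^ 2) / 2 * ‖a - b‖ ^ 2
      = ‖x • a - y • b‖ ^ 2 - (x - y) ^ 2
        + 2 * ((x - y) ^ 2 * ‖(2 : ℝ)⁻¹ • (a - b)‖ ^ 2) := by
  rw [norm_smul, mul_pow, norm_sub_sq_real, norm_sub_sq_real, norm_smul, norm_smul,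
    real_inner_smul_left, real_inner_smul_right, ha, hb, mul_one, mul_one]
  simp only [Real.norm_eq_abs, sq_abs]
  ring

/-- Identity (2.17): the discrete energy identity relating `E₁ʰ[sₕ,nₕ]`,
`Ẽ₁ʰ[sₕ,uₕ]` and the consistency term. -/
theorem discrete_energy_identity
    (N : ℕ) (hN : 1 ≤ N) (k : Fin N → Fin N → ℝ)
    (hsym : ∀ i j, k i j = k j i)
    (hrow : ∀ i, ∑ j, k i j = 0)
    (d : ℕ) (hd : 1 ≤ d)
    (n : Fin N → EuclideanSpace ℝ (Fin d)) (hn : ∀ i, ‖n i‖ = 1)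
    (s : Fin N → ℝ)
    (u : Fin N → EuclideanSpace ℝ (Fin d)) (hu : ∀ i, u i = s i • n i)
    (κ : ℝ) :
    (κ / 2) * ∑ i, ∑ j, k i j * (s i - s j) ^ 2
      + (1 / 2) * ∑ i, ∑ j, k i j * ((s i ^ 2 + s j ^ 2) / 2) * ‖n i - n j‖ ^ 2
    = (κ - 1) * ((1 / 2) * ∑ i, ∑ j, k i j * (s i - s j) ^ 2)
      + (1 / 2) * ∑ i, ∑ j, k i j * ‖u i - u j‖ ^ 2
      + ∑ i, ∑ j, k i j * (s i - s j) ^ 2 * ‖(2 : ℝ)⁻¹ • (n i - n j)‖ ^ 2 := by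
  simp only [Finset.mul_sum, ← Finset.sum_add_distrib]
  refine Finset.sum_congr rfl fun i _ => Finset.sum_congr rfl fun j _ => ?_
  rw [hu i, hu j]
  linear_combination
    (k i j / 2) * mean_sq_mul_norm_sub_sq_of_unit (hn i) (hn j) (s i) (s j)
end

section
/- Let N ≥ 1, and let k : {1,…,N}×{1,…,N} → ℝ be symmetric (k_{ij} = k_{ji}) with zero row sums (∑_{j=1}^N k_{ij} = 0 for every i) and nonnegative off-diagonal entries (k_{ij} ≥ 0 for i ≠ j). Let d ≥ 1, let n_1,…,n_N be unit vectors in ℝ^d, let s_1,…,s_N ∈ ℝ, set u_i := s_i·n_i, and let κ > 0. Then (κ/2) ∑_{i,j} k_{ij} (s_i − s_j)² + (1/2) ∑_{i,j} k_{ij} ((s_i² + s_j²)/2) ‖n_i − n_j‖² ≥ (κ − 1)·(1/2) ∑_{i,j} k_{ij} (s_i − s_j)² + (1/2) ∑_{i,j} k_{ij} ‖u_i − u_j‖². -/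
/-- For unit vectors `x`, `y`, the squared distance of `a • x` and `b • y` splits into a radial
and an angular part. -/
lemma norm_smul_sub_smul_sq_of_norm_eq_one {E : Type*} [NormedAddCommGroup E]
    [InnerProductSpace ℝ E] {x y : E} (hx : ‖x‖ = 1) (hy : ‖y‖ = 1) (a b : ℝ) :
    ‖a • x - b • y‖ ^ 2 = (a - b) ^ 2 + a * b * ‖x - y‖ ^ 2 := by
  rw [norm_sub_sq_real, norm_sub_sq_real, norm_smul, norm_smul, real_inner_smul_left,
    real_inner_smul_right, hx, hy, mul_one, mul_one, Real.norm_eq_abs, Real.norm_eq_abs, sq_abs,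
    sq_abs]
  ring

/-- Inequality (2.15) of Lemma 2.2 (energy inequality):
`E₁ʰ[sₕ,nₕ] ≥ Ẽ₁ʰ[sₕ,uₕ]` on a weakly acute mesh. -/
theorem discrete_energy_inequality
    (N : ℕ) (hN : 1 ≤ N) (k : Fin N → Fin N → ℝ)
    (hsym : ∀ i j, k i j = k j i)
    (hrow : ∀ i, ∑ j, k i j = 0)
    (hpos : ∀ i j, i ≠ j → 0 ≤ k i j)
    (d : ℕ) (hd : 1 ≤ d)
    (n : Fin N → EuclideanSpace ℝ (Fin d)) (hn : ∀ i, ‖n i‖ = 1)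
    (s : Fin N → ℝ)
    (u : Fin N → EuclideanSpace ℝ (Fin d)) (hu : ∀ i, u i = s i • n i)
    (κ : ℝ) (hκ : 0 < κ) :
    (κ / 2) * ∑ i, ∑ j, k i j * (s i - s j) ^ 2
      + (1 / 2) * ∑ i, ∑ j, k i j * ((s i ^ 2 + s j ^ 2) / 2) * ‖n i - n j‖ ^ 2
    ≥ (κ - 1) * ((1 / 2) * ∑ i, ∑ j, k i j * (s i - s j) ^ 2)
      + (1 / 2) * ∑ i, ∑ j, k i j * ‖u i - u j‖ ^ 2 := by
  have hsum : ∑ i, ∑ j, k i j * ‖u i - u j‖ ^ 2 ≤ ∑ i, ∑ j, k i j * (s i - s j) ^ 2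
      + ∑ i, ∑ j, k i j * ((s i ^ 2 + s j ^ 2) / 2) * ‖n i - n j‖ ^ 2 := by
    simp only [← Finset.sum_add_distrib]
    refine Finset.sum_le_sum fun i _ => Finset.sum_le_sum fun j _ => ?_
    rcases eq_or_ne i j with rfl | hij
    · simp
    · rw [hu, hu, norm_smul_sub_smul_sq_of_norm_eq_one (hn i) (hn j)]
      have hdiff : 0 ≤ k i j * ((s i - s j) ^ 2 * ‖n i - n j‖ ^ 2) :=
        mul_nonneg (hpos i j hij) (by positivity)
      linarith
  linarith
end

section
/- Let N ≥ 1, and let k : {1,…,N}×{1,…,N} → ℝ be symmetric (k_{ij} = k_{ji}) with zero row sums (∑_{j=1}^N k_{ij} = 0 for every i) and nonnegative off-diagonal entries (k_{ij} ≥ 0 for i ≠ j). Let d ≥ 1, let s_1,…,s_N ∈ ℝ, let κ > 0, and let v_1,…,v_N ∈ ℝ^d satisfy ‖v_i‖ ≥ 1 for all i; set w_i := v_i/‖v_i‖. Then (κ/2) ∑_{i,j} k_{ij} (s_i − s_j)² + (1/2) ∑_{i,j} k_{ij} ((s_i² + s_j²)/2) ‖w_i − w_j‖² ≤ (κ/2)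 ∑_{i,j} k_{ij} (s_i − s_j)² + (1/2) ∑_{i,j} k_{ij} ((s_i² + s_j²)/2) ‖v_i − v_j‖². -/
/-- Radial projection onto the unit sphere does not increase distances outside the open unit ball. -/
theorem norm_inv_norm_smul_sub_le {E : Type*} [NormedAddCommGroup E] [InnerProductSpace ℝ E]
    {x y : E} (hx : 1 ≤ ‖x‖) (hy : 1 ≤ ‖y‖) :
    ‖‖x‖⁻¹ • x - ‖y‖⁻¹ • y‖ ≤ ‖x - y‖ := by
  have hx0 : ‖x‖ ≠ 0 := by positivity
  have hy0 : ‖y‖ ≠ 0 := by positivity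
  set u := ‖x‖⁻¹ • x with hu
  set z := ‖y‖⁻¹ • y with hz
  have hu1 : ‖u‖ = 1 := by rw [hu, norm_smul, norm_inv, norm_norm, inv_mul_cancel₀ hx0]
  have hz1 : ‖z‖ = 1 := by rw [hz, norm_smul, norm_inv, norm_norm, inv_mul_cancel₀ hy0]
  have hxy : inner ℝ x y = ‖x‖ * ‖y‖ * inner ℝ u z := by
    rw [hu, hz, real_inner_smul_left, real_inner_smul_right]
    field_simp
  have hc : inner ℝ u z ≤ 1 := by
    simpa [hu1, hz1] using real_inner_le_norm u z
  refine (sq_le_sq₀ (norm_nonneg _) (norm_nonneg _)).1 ?_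
  rw [norm_sub_sq_real, norm_sub_sq_real, hxy, hu1, hz1]
  have hab : 1 ≤ ‖x‖ * ‖y‖ := one_le_mul_of_one_le_of_one_le hx hy
  nlinarith [mul_nonneg (sub_nonneg.2 hab) (sub_nonneg.2 hc), sq_nonneg (‖x‖ - ‖y‖)]

/-- Step (b) (projection) in the proof of Theorem 4.2: nodal normalization
does not increase the discrete energy `E₁ʰ[sₕ, ·]` on a weakly acute mesh. -/
theorem projection_decreases_energy
    (N : ℕ) (hN : 1 ≤ N) (k : Fin N → Fin N → ℝ)
    (hsym : ∀ i j, k i j = k j i)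
    (hrow : ∀ i, ∑ j, k i j = 0)
    (hpos : ∀ i j, i ≠ j → 0 ≤ k i j)
    (d : ℕ) (hd : 1 ≤ d)
    (s : Fin N → ℝ) (κ : ℝ) (hκ : 0 < κ)
    (v : Fin N → EuclideanSpace ℝ (Fin d)) (hv : ∀ i, 1 ≤ ‖v i‖)
    (w : Fin N → EuclideanSpace ℝ (Fin d)) (hw : ∀ i, w i = ‖v i‖⁻¹ • v i) :
    (κ / 2) * ∑ i, ∑ j, k i j * (s i - s j) ^ 2
      + (1 / 2) * ∑ i, ∑ j, k i j * ((s i ^ 2 + s j ^ 2) / 2) * ‖w i - w j‖ ^ 2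
    ≤ (κ / 2) * ∑ i, ∑ j, k i j * (s i - s j) ^ 2
      + (1 / 2) * ∑ i, ∑ j, k i j * ((s i ^ 2 + s j ^ 2) / 2) * ‖v i - v j‖ ^ 2 := by
  gcongr _ + _ * ?_
  refine Finset.sum_le_sum fun i _ => Finset.sum_le_sum fun j _ => ?_
  obtain rfl | hij := eq_or_ne i j
  · simp
  · rw [hw i, hw j]
    have hk := hpos i j hij
    gcongr
    exact norm_inv_norm_smul_sub_le (hv i) (hv j)
end

section
/- Let E be a real normed vector space, let ε > 0, and let a, b, c ∈ E with ‖a‖ ≥ ε and ‖c‖ ≥ ε. Then ‖ (a + b)/(‖a‖ + ‖b‖) − c/‖c‖ ‖ ≤ (2‖a − c‖ + 2‖b − c‖)/ε. -/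
/-- Stability estimate for `H(x, y) = (x + y)/(‖x‖ + ‖y‖)` used in Step 2 of
the proof of Lemma 3.2 (weak lower semi-continuity). -/
theorem H_stability_estimate
    {E : Type*} [NormedAddCommGroup E] [NormedSpace ℝ E]
    (ε : ℝ) (hε : 0 < ε)
    (a b c : E) (ha : ε ≤ ‖a‖) (hc : ε ≤ ‖c‖) :
    ‖(‖a‖ + ‖b‖)⁻¹ • (a + b) - ‖c‖⁻¹ • c‖
      ≤ (2 * ‖a - c‖ + 2 * ‖b - c‖) / ε := by
  have hc₀ : ‖c‖ ≠ 0 := (hε.trans_le hc).ne'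
  have hεS : ε ≤ ‖a‖ + ‖b‖ := le_add_of_le_of_nonneg ha (norm_nonneg b)
  have hS : 0 < ‖a‖ + ‖b‖ := hε.trans_le hεS
  have hu : ‖‖c‖⁻¹ • c‖ = 1 := by
    rw [norm_smul, norm_inv, norm_norm, inv_mul_cancel₀ hc₀]
  have hcu : ‖c‖ • (‖c‖⁻¹ • c) = c := smul_inv_smul₀ hc₀ c
  set u := ‖c‖⁻¹ • c
  have key : (‖a‖ + ‖b‖)⁻¹ • (a + b) - u = (‖a‖ + ‖b‖)⁻¹ •
      ((a - c) + (b - c) + ((‖c‖ - ‖a‖) + (‖c‖ - ‖b‖)) • u) := by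
    have hnum : (a - c) + (b - c) + ((‖c‖ - ‖a‖) + (‖c‖ - ‖b‖)) • u
        = (a + b) - (‖a‖ + ‖b‖) • u := by
      simp only [add_smul, sub_smul, hcu]
      abel
    rw [hnum, smul_sub, inv_smul_smul₀ hS.ne']
  have hbound : ‖(a - c) + (b - c) + ((‖c‖ - ‖a‖) + (‖c‖ - ‖b‖)) • u‖
      ≤ 2 * ‖a - c‖ + 2 * ‖b - c‖ := by
    have h₁ := norm_add₃_le (a := a - c) (b := b - c)
      (c := ((‖c‖ - ‖a‖) + (‖c‖ - ‖b‖)) • u)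
    rw [norm_smul, hu, mul_one, Real.norm_eq_abs] at h₁
    have h₂ := abs_add_le (‖c‖ - ‖a‖) (‖c‖ - ‖b‖)
    have h₃ := abs_norm_sub_norm_le c a
    have h₄ := abs_norm_sub_norm_le c b
    rw [norm_sub_rev] at h₃ h₄
    linarith
  rw [key, norm_smul, norm_inv, Real.norm_of_nonneg hS.le, inv_mul_eq_div]
  gcongr
end
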